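/- For every natural number r and every real x in [0,1], the shifted Chebyshev polynomial of the second kind satisfies the Bernstein representation U_r(2x-1) = ((r+1)·(2r)!!/(2r+1)!!) · Σ_{i=0}^{r} (-1)^{r-i} · [C(r+1/2, i)·C(r+1/2, r-i) / C(r,i)] · B_i^r(x), where C(r+1/2, k) denotes the generalized binomial coefficient with real upper argument. -/

import Mathlib

open scoped BigOperators Real

/-- Bernstein basis polynomial `B_i^n(x) = C(n,i) x^i (1-x)^(n-i)`. -/
noncomputable def bern (n i : ℕ) (x : ℝ) : ℝ := (n.choose i : ℝ) * x ^ i * (1 - x) ^ (n - i)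

/-- Chebyshev polynomial of the second kind, evaluated at a real point. -/
noncomputable def chebU (n : ℕ) (x : ℝ) : ℝ := (Polynomial.Chebyshev.U ℝ n).eval x

/-- Generalized binomial coefficient `C(a,k) = a(a-1)⋯(a-k+1)/k!` for real `a`. -/
noncomputable def gchoose (a : ℝ) (k : ℕ) : ℝ :=
  (∏ j ∈ Finset.range k, (a - j)) / (k.factorial : ℝ)

/-- The odd double factorial `(2n+1)!! = (2n+1)! / (2^n n!)`, as a real number. -/
noncomputable def oddDF (n : ℕ) : ℝ := ((2 * n + 1).factorial : ℝ) / (2 ^ n * n.factorial)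

theorem gchoose_succ (a : ℝ) (k : ℕ) : gchoose a (k + 1) = gchoose a k * (a - k) / (k + 1) := by
  have : (k : ℝ) + 1 ≠ 0 := by positivity
  simp only [gchoose, Finset.prod_range_succ, Nat.factorial_succ]
  push_cast
  field_simp

/-- Closed form of the generalized binomial coefficient at the half-integer `k + m + 1/2`. -/
theorem gchoose_add_half (k m : ℕ) :
    gchoose (((k + m : ℕ) : ℝ) + 1 / 2) k =
      ((2 * (k + m) + 1).factorial * m.factorial : ℝ) /
        (4 ^ k * (k + m).factorial * k.factorial * (2 * m + 1).factorial) := by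
  suffices h : ∀ r k m : ℕ, k + m = r → gchoose ((r : ℝ) + 1 / 2) k =
      ((2 * r + 1).factorial * m.factorial : ℝ) /
        (4 ^ k * r.factorial * k.factorial * (2 * m + 1).factorial) from h _ k m rfl
  intro r k
  induction k with
  | zero =>
    rintro m rfl
    simp only [zero_add, gchoose, Finset.range_zero, Finset.prod_empty, Nat.factorial_zero,
      Nat.cast_one, pow_zero, one_mul, mul_one, div_one]
    field_simp
  | succ k ih =>
    intro m hm
    rw [gchoose_succ, ih (m + 1) (by lia), ← hm, show 2 * (m + 1) + 1 = 2 * m + 1 + 1 + 1 by ring]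
    simp only [Nat.factorial_succ (2 * m + 1 + 1), Nat.factorial_succ (2 * m + 1),
      Nat.factorial_succ m, Nat.factorial_succ k]
    push_cast
    field_simp
    ring

theorem gchoose_half_mul_gchoose_half (i j : ℕ) :
    (((i + j : ℕ) : ℝ) + 1) * (2 ^ (i + j) * ((i + j).factorial : ℝ)) / oddDF (i + j) *
        (gchoose (((i + j : ℕ) : ℝ) + 1 / 2) i * gchoose (((i + j : ℕ) : ℝ) + 1 / 2) j) =
      ((2 * (i + j) + 2).choose (2 * j + 1) : ℝ) / 2 := by
  have hj := gchoose_add_half j i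
  rw [add_comm j i] at hj
  rw [gchoose_add_half i j, hj, oddDF, Nat.cast_choose ℝ (by lia),
    show 2 * (i + j) + 2 - (2 * j + 1) = 2 * i + 1 by lia, Nat.factorial_succ (2 * (i + j) + 1),
    show (4 : ℝ) = 2 * 2 by norm_num]
  simp only [mul_pow, pow_add]
  push_cast
  field_simp
  ring

theorem Finset.sum_range_two_mul_eq_sum_even_add_odd {M : Type*} [AddCommMonoid M]
    (f : ℕ → M) (n : ℕ) :
    ∑ k ∈ Finset.range (2 * n), f k = ∑ j ∈ Finset.range n, (f (2 * j) + f (2 * j + 1)) := by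
  induction n with
  | zero => simp
  | succ n ih => rw [mul_add_one, Finset.sum_range_succ, Finset.sum_range_succ, ih,
      Finset.sum_range_succ, add_assoc]

/-- The multiple-angle formula for the sine of an even multiple of `φ`. -/
theorem Real.sin_two_mul_add_two_mul (r : ℕ) (φ : ℝ) :
    Real.sin ((2 * r + 2 : ℕ) * φ) = Real.cos φ * Real.sin φ * ∑ j ∈ Finset.range (r + 1),
      (-1) ^ j * ((2 * r + 2).choose (2 * j + 1) : ℝ) * (Real.cos φ ^ 2) ^ (r - j) *
        (Real.sin φ ^ 2) ^ j := by
  have h := congrArg Complex.im (Complex.cos_add_sin_mul_I_pow (2 * r + 2) (φ : ℂ))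
  have hexp : ((2 * r + 2 : ℕ) : ℂ) * (φ : ℂ) = (((2 * r + 2 : ℕ) * φ : ℝ) : ℂ) := by push_cast; rfl
  rw [hexp, ← Complex.ofReal_cos, ← Complex.ofReal_sin, ← Complex.ofReal_cos,
    ← Complex.ofReal_sin] at h
  have him : ∀ a b : ℝ, ((a : ℂ) + b * Complex.I).im = b := by intro a b; simp
  rw [him, add_comm, add_pow, Finset.sum_range_succ, show 2 * r + 2 = 2 * (r + 1) by ring,
    Finset.sum_range_two_mul_eq_sum_even_add_odd] at h
  have heven : ∀ j n : ℕ, ((((Real.sin φ : ℝ) : ℂ) * Complex.I) ^ (2 * j) *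
      ((Real.cos φ : ℝ) : ℂ) ^ n) = ((-1) ^ j * Real.sin φ ^ (2 * j) * Real.cos φ ^ n : ℝ) := by
    intro j n
    rw [mul_pow, pow_mul Complex.I, Complex.I_sq]
    push_cast
    ring
  have hodd : ∀ j n : ℕ, ((((Real.sin φ : ℝ) : ℂ) * Complex.I) ^ (2 * j + 1) *
      ((Real.cos φ : ℝ) : ℂ) ^ n) =
      ((-1) ^ j * Real.sin φ ^ (2 * j + 1) * Real.cos φ ^ n : ℝ) * Complex.I := by
    intro j n
    rw [pow_succ, mul_pow, pow_mul Complex.I, Complex.I_sq]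
    push_cast
    ring
  have him_cast : ∀ (z : ℂ) (n : ℕ), (z * n).im = z.im * n := by intro z n; simp
  simp only [heven, hodd, Complex.add_im, Complex.im_sum, him_cast,
    Complex.ofReal_im, Complex.im_ofReal_mul, Complex.I_im, zero_mul,
    zero_add, add_zero, mul_one] at h
  rw [show 2 * r + 2 = 2 * (r + 1) by ring, ← h, Finset.mul_sum]
  refine Finset.sum_congr rfl fun j hj => ?_
  obtain ⟨i, rfl⟩ := Nat.exists_eq_add_of_le' (Finset.mem_range_succ_iff.mp hj)
  rw [show 2 * (i + j + 1) - (2 * j + 1) = 2 * i + 1 by lia, Nat.add_sub_cancel]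
  ring

/-- The Bernstein form of the shifted `U_r` with integer binomial coefficients. -/
theorem chebU_eq_sum_choose (r : ℕ) {x : ℝ} (hx : x ∈ Set.Icc (0 : ℝ) 1) :
    chebU r (2 * x - 1) = ∑ j ∈ Finset.range (r + 1),
      (-1) ^ j * (((2 * r + 2).choose (2 * j + 1) : ℝ) / 2) * x ^ (r - j) * (1 - x) ^ j := by
  suffices h : Set.EqOn (fun x : ℝ => chebU r (2 * x - 1)) (fun x => ∑ j ∈ Finset.range (r + 1),
      (-1) ^ j * (((2 * r + 2).choose (2 * j + 1) : ℝ) / 2) * x ^ (r - j) * (1 - x) ^ j)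
      (Set.Ioo 0 1) by
    refine h.closure ?_ (by fun_prop) (by rwa [closure_Ioo zero_ne_one])
    exact (Polynomial.continuous _).comp (by fun_prop)
  rintro y ⟨h0, h1⟩
  obtain ⟨φ, rfl⟩ : ∃ φ, y = Real.cos φ ^ 2 := by
    refine ⟨Real.arccos √y, ?_⟩
    rw [Real.cos_arccos (by linarith [Real.sqrt_nonneg y]) (Real.sqrt_le_one.mpr h1.le),
      Real.sq_sqrt h0.le]
  have hs : 1 - Real.cos φ ^ 2 = Real.sin φ ^ 2 := (Real.sin_sq φ).symm
  have hc : Real.cos φ ≠ 0 := by rintro h; simp [h] at h0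
  have hs0 : Real.sin φ ≠ 0 := by rintro h; rw [h] at hs; linarith
  have hU := Polynomial.Chebyshev.U_real_cos (2 * φ) r
  have hsin := Real.sin_two_mul_add_two_mul r φ
  rw [show ((2 * r + 2 : ℕ) : ℝ) * φ = ((r : ℤ) + 1) * (2 * φ) by push_cast; ring, ← hU,
    Real.sin_two_mul, Real.cos_two_mul] at hsin
  simp only [chebU, hs]
  apply mul_right_cancel₀ (mul_ne_zero (mul_ne_zero two_ne_zero hs0) hc)
  rw [hsin, Finset.mul_sum, Finset.sum_mul]
  refine Finset.sum_congr rfl fun j _ => ?_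
  ring

/-- The Bernstein representation of the shifted Chebyshev polynomial of the second kind:
`U_r(2x-1) = ((r+1)(2r)!!/(2r+1)!!) Σ_{i=0}^r (-1)^{r-i} C(r+1/2,i)C(r+1/2,r-i)/C(r,i) · B_i^r(x)`,
where `(2r)!! = 2^r r!`. -/
theorem chebU_bernstein_representation (r : ℕ) (x : ℝ) (hx : x ∈ Set.Icc (0 : ℝ) 1) :
    chebU r (2 * x - 1) =
      ((r : ℝ) + 1) * (2 ^ r * (r.factorial : ℝ)) / oddDF r *
        ∑ i ∈ Finset.range (r + 1),
          (-1 : ℝ) ^ (r - i) *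
            (gchoose ((r : ℝ) + 1 / 2) i * gchoose ((r : ℝ) + 1 / 2) (r - i) /
              (r.choose i : ℝ)) * bern r i x := by
  rw [chebU_eq_sum_choose r hx, ← Finset.sum_range_reflect, Finset.mul_sum]
  refine Finset.sum_congr rfl fun i hi => ?_
  obtain ⟨j, rfl⟩ := Nat.exists_eq_add_of_le (Finset.mem_range_succ_iff.mp hi)
  have hchoose : ((i + j).choose i : ℝ) ≠ 0 := by
    exact_mod_cast (Nat.choose_pos (Nat.le_add_right i j)).ne'
  rw [show i + j + 1 - 1 - i = j by lia, Nat.add_sub_cancel, Nat.add_sub_cancel_left,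
    ← gchoose_half_mul_gchoose_half, bern, Nat.add_sub_cancel_left]
  field_simp
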